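/- For every ε ∈ (0,1) there exists a constant C = C(ε), independent of φ, such that for every φ ∈ L¹(0,1) there exists an ε-sparse family 𝒮 ⊆ 𝒟 (depending on ε and φ) with Sφ(x) ≤ C · S^sp_𝒮 φ(x) for almost every x ∈ (0,1). -/

import Mathlib

open MeasureTheory

noncomputable section

/-- The dyadic interval `[k/2^n, (k+1)/2^n)`. -/
def dyadicI (n k : ℕ) : Set ℝ := Set.Ico ((k : ℝ) / 2 ^ n) (((k : ℝ) + 1) / 2 ^ n)

/-- The length of a dyadic interval of generation `n`. -/
def dyadicLen (n : ℕ) : ℝ := 1 / 2 ^ n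

/-- The average `⟨f⟩_I` of `f` over the dyadic interval `I = (n,k)`. -/
def avg (f : ℝ → ℝ) (n k : ℕ) : ℝ := (2 : ℝ) ^ n * ∫ x in dyadicI n k, f x

/-- The martingale difference `Δ_I f = ⟨f⟩_{I₊} - ⟨f⟩_{I₋}` for `I = (n,k)`. -/
def haarDiff (f : ℝ → ℝ) (n k : ℕ) : ℝ :=
  avg f (n + 1) (2 * k + 1) - avg f (n + 1) (2 * k)

/-- The square of the dyadic square function, `(Sφ(x))² = Σ_{I∈𝒟} (Δ_I φ)² 1_I(x)`,
valued in `ℝ≥0∞`. -/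
def sqFnSq (φ : ℝ → ℝ) (x : ℝ) : ENNReal :=
  ∑' nk : ℕ × ℕ, Set.indicator (dyadicI nk.1 nk.2)
    (fun _ => ENNReal.ofReal ((haarDiff φ nk.1 nk.2) ^ 2)) x

/-- A family `𝒮` of dyadic intervals of `[0,1)` (encoded by pairs `(n,k)`, `k < 2^n`) is
`ε`-sparse: for every `J ∈ 𝒮`, `Σ_{I ∈ 𝒮, I ⊊ J} |I| ≤ ε |J|` (expressed through all finite
subfamilies). -/
def IsSparse (ε : ℝ) (𝒮 : Set (ℕ × ℕ)) : Prop :=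
  (∀ p ∈ 𝒮, p.2 < 2 ^ p.1) ∧
  ∀ p ∈ 𝒮, ∀ F : Finset (ℕ × ℕ),
    (∀ q ∈ F, q ∈ 𝒮 ∧ dyadicI q.1 q.2 ⊂ dyadicI p.1 p.2) →
    ∑ q ∈ F, dyadicLen q.1 ≤ ε * dyadicLen p.1

/-- The square of the sparse square function, `(S^sp_𝒮 φ(x))² = Σ_{I∈𝒮} ⟨|φ|⟩_I² 1_I(x)`,
valued in `ℝ≥0∞`. -/
def sparseSqSq (𝒮 : Set (ℕ × ℕ)) (φ : ℝ → ℝ) (x : ℝ) : ENNReal :=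
  ∑' p : 𝒮, Set.indicator (dyadicI p.1.1 p.1.2)
    (fun _ => ENNReal.ofReal ((avg (fun y => |φ y|) p.1.1 p.1.2) ^ 2)) x

/-- The pair `(a, A)` attached to the dyadic interval `(n, k)`: `a` is the value of `v` at the
smallest selected interval containing it, and `A` is the sum of the squared differences of `u`
from that selected interval down to the parent of `(n, k)`. -/
def stopState (lam : ℝ) (u v : ℕ → ℕ → ℝ) : ℕ → ℕ → ℝ × ℝ
  | 0, k => (v 0 k, 0)
  | n + 1, k =>
    open Classical in
    if lam * (stopState lam u v n (k / 2)).1 < v (n + 1) k ∨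
        8 * lam ^ 2 * (stopState lam u v n (k / 2)).1 ^ 2 <
          (stopState lam u v n (k / 2)).2 +
            (u (n + 1) (2 * (k / 2) + 1) - u (n + 1) (2 * (k / 2))) ^ 2
    then (v (n + 1) k, 0)
    else ((stopState lam u v n (k / 2)).1,
      (stopState lam u v n (k / 2)).2 +
        (u (n + 1) (2 * (k / 2) + 1) - u (n + 1) (2 * (k / 2))) ^ 2)

/-- The interval `(n, k)` is selected by the stopping procedure. -/
def IsSelected (lam : ℝ) (u v : ℕ → ℕ → ℝ) : ℕ → ℕ → Prop
  | 0, _ => True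
  | n + 1, k =>
    lam * (stopState lam u v n (k / 2)).1 < v (n + 1) k ∨
        8 * lam ^ 2 * (stopState lam u v n (k / 2)).1 ^ 2 <
          (stopState lam u v n (k / 2)).2 +
            (u (n + 1) (2 * (k / 2) + 1) - u (n + 1) (2 * (k / 2))) ^ 2

/-- `u` and `v` behave like the dyadic averages of a function and of its absolute value. -/
structure IsDyadicPair (u v : ℕ → ℕ → ℝ) : Prop where
  mean_signed : ∀ n k, k < 2 ^ n → u n k = (u (n + 1) (2 * k) + u (n + 1) (2 * k + 1)) / 2
  mean_majorant : ∀ n k, k < 2 ^ n → v n k = (v (n + 1) (2 * k) + v (n + 1) (2 * k + 1)) / 2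
  abs_le_majorant : ∀ n k, k < 2 ^ n → |u n k| ≤ v n k

/-- A Bellman function controlling the relative measure of the selected intervals. -/
def bellman (lam u v a A : ℝ) : ℝ :=
  2 * v / (lam * a) + (A - 4 * u ^ 2) / (8 * lam ^ 2 * a ^ 2)

section Stopping

variable {lam : ℝ} {u v : ℕ → ℕ → ℝ}

lemma stopState_succ_of_selected {n k : ℕ} (h : IsSelected lam u v (n + 1) k) :
    stopState lam u v (n + 1) k = (v (n + 1) k, 0) := by
  rw [stopState]
  exact if_pos h

lemma stopState_succ_of_not_selected {n k : ℕ} (h : ¬ IsSelected lam u v (n + 1) k) :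
    stopState lam u v (n + 1) k = ((stopState lam u v n (k / 2)).1,
      (stopState lam u v n (k / 2)).2 +
        (u (n + 1) (2 * (k / 2) + 1) - u (n + 1) (2 * (k / 2))) ^ 2) := by
  rw [stopState]
  exact if_neg h

lemma stopState_of_selected {n k : ℕ} (h : IsSelected lam u v n k) :
    stopState lam u v n k = (v n k, 0) := by
  cases n with
  | zero => rfl
  | succ n => exact stopState_succ_of_selected h

lemma IsDyadicPair.nonneg (H : IsDyadicPair u v) {n k : ℕ} (hk : k < 2 ^ n) : 0 ≤ v n k :=
  (abs_nonneg _).trans (H.abs_le_majorant n k hk)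

lemma stopState_bounds (hlam : 1 ≤ lam) (H : IsDyadicPair u v) (n k : ℕ) (hk : k < 2 ^ n) :
    0 ≤ (stopState lam u v n k).1 ∧ v n k ≤ lam * (stopState lam u v n k).1 ∧
      0 ≤ (stopState lam u v n k).2 ∧
      (stopState lam u v n k).2 ≤ 8 * lam ^ 2 * (stopState lam u v n k).1 ^ 2 := by
  by_cases hs : IsSelected lam u v n k
  · rw [stopState_of_selected hs]
    have := H.nonneg hk
    exact ⟨this, by dsimp only; nlinarith, le_rfl, by positivity⟩
  · induction n generalizing k with
    | zero => exact absurd trivial hs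
    | succ n ih =>
      have hk' : k / 2 < 2 ^ n := by rw [pow_succ] at hk; omega
      have key : 0 ≤ (stopState lam u v n (k / 2)).1 ∧
          0 ≤ (stopState lam u v n (k / 2)).2 := by
        by_cases hs' : IsSelected lam u v n (k / 2)
        · rw [stopState_of_selected hs']
          exact ⟨H.nonneg hk', le_rfl⟩
        · exact ⟨(ih _ hk' hs').1, (ih _ hk' hs').2.2.1⟩
      rw [stopState_succ_of_not_selected hs]
      simp only [IsSelected, not_or, not_lt] at hs
      exact ⟨key.1, hs.1, add_nonneg key.2 (sq_nonneg _), hs.2⟩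

lemma IsDyadicPair.sq_sub_le (H : IsDyadicPair u v) {n k : ℕ} (hk : k < 2 ^ n) :
    (u (n + 1) (2 * k + 1) - u (n + 1) (2 * k)) ^ 2 ≤ 4 * v n k ^ 2 := by
  have h1 := abs_le.1 (H.abs_le_majorant (n + 1) (2 * k) (by rw [pow_succ]; omega))
  have h2 := abs_le.1 (H.abs_le_majorant (n + 1) (2 * k + 1) (by rw [pow_succ]; omega))
  have h3 := H.mean_majorant n k hk
  have : |u (n + 1) (2 * k + 1) - u (n + 1) (2 * k)| ≤ 2 * v n k :=
    abs_le.2 ⟨by linarith [h1.2, h2.1], by linarith [h1.1, h2.2]⟩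
  calc _ ≤ (2 * v n k) ^ 2 := sq_le_sq' (abs_le.1 this).1 (abs_le.1 this).2
    _ = _ := by ring

lemma bellman_ge {lam u v a A : ℝ} (hlam : 0 < lam) (ha : 0 < a) (hu : |u| ≤ v)
    (hv : v ≤ 2 * lam * a) :
    v / (lam * a) + A / (8 * lam ^ 2 * a ^ 2) ≤ bellman lam u v a A := by
  have h1 : u ^ 2 ≤ 2 * lam * a * v := by
    have h0 : 0 ≤ v := (abs_nonneg u).trans hu
    rw [← sq_abs]
    nlinarith [abs_nonneg u]
  have h2 : bellman lam u v a A - (v / (lam * a) + A / (8 * lam ^ 2 * a ^ 2))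
      = 4 * (2 * lam * a * v - u ^ 2) / (8 * lam ^ 2 * a ^ 2) := by
    unfold bellman
    field_simp
    ring
  have h3 : 0 ≤ 4 * (2 * lam * a * v - u ^ 2) / (8 * lam ^ 2 * a ^ 2) :=
    div_nonneg (by linarith) (by positivity)
  linarith

lemma bellman_self_le {lam u v : ℝ} (hlam : 0 < lam) : bellman lam u v v 0 ≤ 2 / lam := by
  have h1 : 2 * v / (lam * v) ≤ 2 / lam := by
    rcases eq_or_ne v 0 with rfl | hv
    · simp; positivity
    · rw [mul_div_mul_right _ _ hv]
  have h2 : (0 - 4 * u ^ 2) / (8 * lam ^ 2 * v ^ 2) ≤ 0 :=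
    div_nonpos_of_nonpos_of_nonneg (by nlinarith [sq_nonneg u]) (by positivity)
  unfold bellman
  linarith

lemma bellman_mean {lam u u₀ u₁ v v₀ v₁ a A : ℝ} (hu : u = (u₀ + u₁) / 2)
    (hv : v = (v₀ + v₁) / 2) :
    bellman lam u₀ v₀ a (A + (u₁ - u₀) ^ 2) + bellman lam u₁ v₁ a (A + (u₁ - u₀) ^ 2)
      = 2 * bellman lam u v a A := by
  subst hu hv
  unfold bellman
  ring

/-- The value of the Bellman function at the dyadic interval `(n, k)`. -/
def nodeBellman (lam : ℝ) (u v : ℕ → ℕ → ℝ) (n k : ℕ) : ℝ :=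
  bellman lam (u n k) (v n k) (stopState lam u v n k).1 (stopState lam u v n k).2

lemma nodeBellman_nonneg (hlam : 1 ≤ lam) (H : IsDyadicPair u v) {n k : ℕ} (hk : k < 2 ^ n) :
    0 ≤ nodeBellman lam u v n k := by
  obtain ⟨h1, h2, h3, -⟩ := stopState_bounds hlam H n k hk
  have hv := H.nonneg hk
  have h0 : 0 < lam := by linarith
  unfold nodeBellman
  rcases h1.eq_or_lt with h | h
  · rw [← h]; simp [bellman]
  · refine le_trans (by positivity) (bellman_ge h0 h (H.abs_le_majorant n k hk) ?_)
    nlinarith [mul_pos h0 h]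

open Classical in
lemma child_le (hlam : 2 < lam) (H : IsDyadicPair u v) {n k c : ℕ} (hk : k < 2 ^ n)
    (hc : c / 2 = k) :
    (if IsSelected lam u v (n + 1) c then 1 else 0) +
        lam / (lam - 2) * nodeBellman lam u v (n + 1) c ≤
      lam / (lam - 2) * bellman lam (u (n + 1) c) (v (n + 1) c) (stopState lam u v n k).1
        ((stopState lam u v n k).2 + (u (n + 1) (2 * k + 1) - u (n + 1) (2 * k)) ^ 2) := by
  subst hc
  set k := c / 2 with hkd
  have h0 : 0 < lam := by linarith
  have hK : 0 < lam / (lam - 2) := div_pos h0 (by linarith)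
  by_cases hs : IsSelected lam u v (n + 1) c
  · rw [if_pos hs]
    obtain ⟨h1, h2, h3, h4⟩ := stopState_bounds (lam := lam) (by linarith) H n k hk
    have hc : c < 2 ^ (n + 1) := by rw [pow_succ]; omega
    have hvc := H.nonneg hc
    have hv2 : v (n + 1) c ≤ 2 * v n k := by
      have e := H.mean_majorant n k hk
      have e0 := H.nonneg (n := n + 1) (k := 2 * k) (by rw [pow_succ]; omega)
      have e1 := H.nonneg (n := n + 1) (k := 2 * k + 1) (by rw [pow_succ]; omega)
      rcases (by omega : c = 2 * k ∨ c = 2 * k + 1) with h | h <;> rw [h] <;> linarith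
    have hD := H.sq_sub_le hk
    have hv := H.nonneg hk
    have ha : 0 < (stopState lam u v n k).1 := by
      rcases h1.eq_or_lt with h | h
      · exfalso
        rw [← h] at h2 h4
        have hv0 : v n k = 0 := by linarith
        rw [hv0] at hv2 hD
        simp only [IsSelected, ← hkd] at hs
        rw [← h] at hs
        rcases hs with hs | hs <;> nlinarith
      · exact h
    have hB := bellman_ge (lam := lam)
      (A := (stopState lam u v n k).2 + (u (n + 1) (2 * k + 1) - u (n + 1) (2 * k)) ^ 2)
      h0 ha (H.abs_le_majorant _ _ hc) (by linarith)
    have hone : 1 ≤ v (n + 1) c / (lam * (stopState lam u v n k).1) +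
        ((stopState lam u v n k).2 + (u (n + 1) (2 * k + 1) - u (n + 1) (2 * k)) ^ 2) /
          (8 * lam ^ 2 * (stopState lam u v n k).1 ^ 2) := by
      have p1 : 0 ≤ v (n + 1) c / (lam * (stopState lam u v n k).1) := by positivity
      have p2 : 0 ≤ ((stopState lam u v n k).2 +
          (u (n + 1) (2 * k + 1) - u (n + 1) (2 * k)) ^ 2) /
          (8 * lam ^ 2 * (stopState lam u v n k).1 ^ 2) := by positivity
      rcases hs with hs | hs
      · have := (one_le_div (by positivity)).2 hs.le
        linarith
      · have := (one_le_div (by positivity)).2 hs.le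
        linarith
    have hself : nodeBellman lam u v (n + 1) c ≤ 2 / lam := by
      unfold nodeBellman
      rw [stopState_of_selected hs]
      exact bellman_self_le h0
    have e : 1 + lam / (lam - 2) * (2 / lam) = lam / (lam - 2) * 1 := by
      have : lam - 2 ≠ 0 := by linarith
      field_simp
      ring
    calc _ ≤ 1 + lam / (lam - 2) * (2 / lam) := by gcongr
      _ = lam / (lam - 2) * 1 := e
      _ ≤ _ := by gcongr; exact hone.trans hB
  · rw [if_neg hs, nodeBellman, stopState_succ_of_not_selected hs, zero_add]

open Classical in
lemma children_le (hlam : 2 < lam) (H : IsDyadicPair u v) {n k : ℕ} (hk : k < 2 ^ n) :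
    ((if IsSelected lam u v (n + 1) (2 * k) then 1 else 0) +
        lam / (lam - 2) * nodeBellman lam u v (n + 1) (2 * k)) +
      ((if IsSelected lam u v (n + 1) (2 * k + 1) then 1 else 0) +
        lam / (lam - 2) * nodeBellman lam u v (n + 1) (2 * k + 1)) ≤
      2 * (lam / (lam - 2) * nodeBellman lam u v n k) := by
  have h0 := child_le hlam H hk (c := 2 * k) (by omega)
  have h1 := child_le hlam H hk (c := 2 * k + 1) (by omega)
  have h2 := bellman_mean (lam := lam) (a := (stopState lam u v n k).1)
    (A := (stopState lam u v n k).2) (H.mean_signed n k hk) (H.mean_majorant n k hk)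
  refine (add_le_add h0 h1).trans (le_of_eq ?_)
  rw [← mul_add, h2, nodeBellman]
  ring

lemma sum_selected_descendants_le (hlam : 2 < lam) (H : IsDyadicPair u v) (N : ℕ) :
    ∀ (n k : ℕ), k < 2 ^ n → ∀ F : Finset (ℕ × ℕ),
      (∀ q ∈ F, IsSelected lam u v q.1 q.2 ∧ n < q.1 ∧ q.1 ≤ n + N ∧
        q.2 / 2 ^ (q.1 - n) = k) →
      ∑ q ∈ F, dyadicLen q.1 ≤ dyadicLen n * (lam / (lam - 2) * nodeBellman lam u v n k) := by
  classical
  have hK : 0 < lam / (lam - 2) := div_pos (by linarith) (by linarith)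
  have hlen : ∀ n, 0 < dyadicLen n := fun n => by unfold dyadicLen; positivity
  induction N with
  | zero =>
    intro n k hk F hF
    have : F = ∅ := Finset.eq_empty_of_forall_notMem fun q hq => by
      have := hF q hq; omega
    subst this
    simpa using mul_nonneg (hlen n).le
      (mul_nonneg hK.le (nodeBellman_nonneg (lam := lam) (by linarith) H hk))
  | succ N ih =>
    intro n k hk F hF
    have part : ∀ c, c / 2 = k →
        ∑ q ∈ F.filter (fun q => q.2 / 2 ^ (q.1 - (n + 1)) = c), dyadicLen q.1 ≤
          dyadicLen (n + 1) * ((if IsSelected lam u v (n + 1) c then 1 else 0) +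
            lam / (lam - 2) * nodeBellman lam u v (n + 1) c) := by
      intro c hc
      have hc' : c < 2 ^ (n + 1) := by rw [pow_succ]; omega
      set G := F.filter (fun q => q.2 / 2 ^ (q.1 - (n + 1)) = c) with hG
      have h1 := ih (n + 1) c hc' (G.erase (n + 1, c)) (by
        intro q hq
        rw [Finset.mem_erase, hG, Finset.mem_filter] at hq
        obtain ⟨hne, hqF, hqc⟩ := hq
        obtain ⟨a1, a2, a3, -⟩ := hF q hqF
        refine ⟨a1, lt_of_le_of_ne a2 fun h => hne ?_, by omega, hqc⟩
        rw [← h] at hqc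
        exact Prod.ext h.symm (by simpa using hqc))
      by_cases hmem : (n + 1, c) ∈ G
      · rw [← Finset.add_sum_erase _ _ hmem, if_pos (hF _ (Finset.mem_filter.1 hmem).1).1,
          mul_add, mul_one]
        exact add_le_add le_rfl h1
      · rw [Finset.erase_eq_of_notMem hmem] at h1
        refine h1.trans (mul_le_mul_of_nonneg_left ?_ (hlen _).le)
        split_ifs <;> linarith
    have hsub : F ⊆ F.filter (fun q => q.2 / 2 ^ (q.1 - (n + 1)) = 2 * k) ∪
        F.filter (fun q => q.2 / 2 ^ (q.1 - (n + 1)) = 2 * k + 1) := by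
      intro q hq
      obtain ⟨-, a2, -, a4⟩ := hF q hq
      rw [show q.1 - n = (q.1 - (n + 1)) + 1 by omega, pow_succ, ← Nat.div_div_eq_div_mul] at a4
      rw [← Finset.filter_or, Finset.mem_filter]
      exact ⟨hq, by omega⟩
    have hdisj : Disjoint (F.filter (fun q => q.2 / 2 ^ (q.1 - (n + 1)) = 2 * k))
        (F.filter (fun q => q.2 / 2 ^ (q.1 - (n + 1)) = 2 * k + 1)) :=
      Finset.disjoint_filter.2 fun q _ h => by omega
    have hhalf : dyadicLen n = 2 * dyadicLen (n + 1) := by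
      unfold dyadicLen; rw [pow_succ]; field_simp
    calc ∑ q ∈ F, dyadicLen q.1 ≤ _ :=
          Finset.sum_le_sum_of_subset_of_nonneg hsub fun q _ _ => (hlen q.1).le
      _ = _ := Finset.sum_union hdisj
      _ ≤ _ := add_le_add (part (2 * k) (by omega)) (part (2 * k + 1) (by omega))
      _ ≤ dyadicLen (n + 1) * (2 * (lam / (lam - 2) * nodeBellman lam u v n k)) := by
          rw [← mul_add]
          exact mul_le_mul_of_nonneg_left (children_le hlam H hk) (hlen _).le
      _ = _ := by rw [hhalf]; ring

open Classical in
lemma sum_sq_sub_le (hlam : 1 ≤ lam) (H : IsDyadicPair u v) (κ : ℕ → ℕ)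
    (hκ : ∀ n, κ n < 2 ^ n) (hκ' : ∀ n, κ (n + 1) / 2 = κ n) (n : ℕ) :
    ∑ m ∈ Finset.range n, (u (m + 1) (2 * κ m + 1) - u (m + 1) (2 * κ m)) ^ 2 +
        (12 * lam ^ 2 * (stopState lam u v n (κ n)).1 ^ 2 - (stopState lam u v n (κ n)).2) ≤
      12 * lam ^ 2 * ∑ m ∈ Finset.range (n + 1),
        if IsSelected lam u v m (κ m) then v m (κ m) ^ 2 else 0 := by
  induction n with
  | zero => simp [stopState, IsSelected]
  | succ n ih =>
    rw [Finset.sum_range_succ, Finset.sum_range_succ _ (n + 1), mul_add]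
    by_cases hs : IsSelected lam u v (n + 1) (κ (n + 1))
    · rw [if_pos hs, stopState_of_selected hs]
      obtain ⟨h1, h2, h3, h4⟩ := stopState_bounds hlam H n (κ n) (hκ n)
      have hD := H.sq_sub_le (hκ n)
      have hv : v n (κ n) ^ 2 ≤ (lam * (stopState lam u v n (κ n)).1) ^ 2 :=
        pow_le_pow_left₀ (H.nonneg (hκ n)) h2 2
      rw [mul_pow] at hv
      dsimp only
      linarith
    · rw [if_neg hs, stopState_succ_of_not_selected hs, hκ']
      dsimp only
      linarith

end Stopping

lemma dyadicI_eq_union (n k : ℕ) :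
    dyadicI n k = dyadicI (n + 1) (2 * k) ∪ dyadicI (n + 1) (2 * k + 1) := by
  have h : (0 : ℝ) < 2 ^ n := by positivity
  have e1 : ((2 * k : ℕ) : ℝ) / 2 ^ (n + 1) = k / 2 ^ n := by
    push_cast; rw [pow_succ]; field_simp
  have e2 : (((2 * k : ℕ) : ℝ) + 1) / 2 ^ (n + 1) = ((2 * k + 1 : ℕ) : ℝ) / 2 ^ (n + 1) := by
    push_cast; rfl
  have e3 : (((2 * k + 1 : ℕ) : ℝ) + 1) / 2 ^ (n + 1) = (k + 1) / 2 ^ n := by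
    push_cast; rw [pow_succ]; field_simp; ring
  unfold dyadicI
  rw [e2, Set.Ico_union_Ico_eq_Ico, e1, e3]
  · gcongr; omega
  · gcongr; linarith

lemma disjoint_dyadicI_children (n k : ℕ) :
    Disjoint (dyadicI (n + 1) (2 * k)) (dyadicI (n + 1) (2 * k + 1)) := by
  have e2 : (((2 * k : ℕ) : ℝ) + 1) / 2 ^ (n + 1) = ((2 * k + 1 : ℕ) : ℝ) / 2 ^ (n + 1) := by
    push_cast; rfl
  unfold dyadicI
  rw [e2]
  exact Set.Ico_disjoint_Ico_same

lemma dyadicI_subset_unit {n k : ℕ} (hk : k < 2 ^ n) : dyadicI n k ⊆ Set.Ico 0 1 := by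
  refine Set.Ico_subset_Ico (by positivity) ?_
  rw [div_le_one (by positivity)]
  exact_mod_cast hk

lemma avg_eq_mean {f : ℝ → ℝ} (hf : IntegrableOn f (Set.Ico (0 : ℝ) 1)) {n k : ℕ}
    (hk : k < 2 ^ n) :
    avg f n k = (avg f (n + 1) (2 * k) + avg f (n + 1) (2 * k + 1)) / 2 := by
  unfold avg
  rw [dyadicI_eq_union n k, setIntegral_union (disjoint_dyadicI_children n k) measurableSet_Ico
    (hf.mono_set (dyadicI_subset_unit (by rw [pow_succ]; omega)))
    (hf.mono_set (dyadicI_subset_unit (by rw [pow_succ]; omega))), pow_succ]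
  ring

lemma isDyadicPair_avg {f : ℝ → ℝ} (hf : IntegrableOn f (Set.Ico (0 : ℝ) 1)) :
    IsDyadicPair (avg f) (avg fun y => |f y|) where
  mean_signed _ _ := avg_eq_mean hf
  mean_majorant _ _ := avg_eq_mean hf.abs
  abs_le_majorant n k _ := by
    unfold avg
    rw [abs_mul, abs_of_pos (by positivity : (0 : ℝ) < 2 ^ n)]
    gcongr
    exact abs_integral_le_integral_abs

lemma descendant_of_ssubset {p q : ℕ × ℕ} (h : dyadicI q.1 q.2 ⊂ dyadicI p.1 p.2) :
    p.1 < q.1 ∧ q.2 / 2 ^ (q.1 - p.1) = p.2 := by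
  obtain ⟨n, k⟩ := p
  obtain ⟨m, j⟩ := q
  dsimp only at h ⊢
  have hsub := h.1
  unfold dyadicI at hsub
  rw [Set.Ico_subset_Ico_iff (by gcongr; linarith)] at hsub
  obtain ⟨h1, h2⟩ := hsub
  rcases le_or_gt m n with hmn | hmn
  · exfalso
    obtain ⟨d, rfl⟩ := Nat.exists_eq_add_of_le hmn
    rw [pow_add] at h1 h2
    rw [div_le_div_iff₀ (by positivity) (by positivity)] at h1 h2
    have hp : (0 : ℝ) < 2 ^ m := by positivity
    have h1' : (k : ℝ) ≤ j * 2 ^ d := le_of_mul_le_mul_right (by linarith) hp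
    have h2' : ((j : ℝ) + 1) * 2 ^ d ≤ k + 1 := le_of_mul_le_mul_right (by linarith) hp
    have hd : d = 0 := by
      by_contra hd
      have : (2 : ℝ) ≤ 2 ^ d := le_self_pow₀ (by norm_num) hd
      linarith
    subst hd
    have hkj : k = j := by
      apply le_antisymm
      · exact_mod_cast (by simpa using h1' : (k : ℝ) ≤ j)
      · exact_mod_cast (by simpa using h2' : (j : ℝ) ≤ k)
    subst hkj
    exact h.ne rfl
  · refine ⟨hmn, ?_⟩
    obtain ⟨d, rfl⟩ := Nat.exists_eq_add_of_le hmn.le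
    rw [pow_add] at h1 h2
    rw [div_le_div_iff₀ (by positivity) (by positivity)] at h1 h2
    have hp : (0 : ℝ) < 2 ^ n := by positivity
    have h1' : (k : ℝ) * 2 ^ d ≤ j := le_of_mul_le_mul_right (by linarith) hp
    have h2' : (j : ℝ) + 1 ≤ (k + 1) * 2 ^ d := le_of_mul_le_mul_right (by linarith) hp
    rw [Nat.add_sub_cancel_left]
    exact Nat.div_eq_of_lt_le (by exact_mod_cast h1') (by exact_mod_cast h2')

lemma mem_dyadicI_iff {x : ℝ} (hx : 0 ≤ x) (n k : ℕ) :
    x ∈ dyadicI n k ↔ k = ⌊x * 2 ^ n⌋₊ := by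
  rw [dyadicI, Set.mem_Ico, div_le_iff₀ (by positivity), lt_div_iff₀ (by positivity), eq_comm,
    Nat.floor_eq_iff (by positivity)]

lemma tsum_indicator_dyadicI {x : ℝ} (hx : 0 ≤ x) (g : ℕ × ℕ → ENNReal) :
    ∑' p : ℕ × ℕ, Set.indicator (dyadicI p.1 p.2) (fun _ => g p) x =
      ∑' n : ℕ, g (n, ⌊x * 2 ^ n⌋₊) := by
  rw [ENNReal.tsum_prod']
  refine tsum_congr fun n => ?_
  rw [tsum_eq_single ⌊x * 2 ^ n⌋₊]
  · exact Set.indicator_of_mem ((mem_dyadicI_iff hx _ _).2 rfl) _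
  · intro k hk
    exact Set.indicator_of_notMem (fun h => hk ((mem_dyadicI_iff hx _ _).1 h)) _

lemma sqFnSq_le {lam x : ℝ} (hlam : 1 ≤ lam) (hx : x ∈ Set.Ico (0 : ℝ) 1) {φ : ℝ → ℝ}
    (hφ : IntegrableOn φ (Set.Ico (0 : ℝ) 1)) :
    sqFnSq φ x ≤ ENNReal.ofReal (12 * lam ^ 2) *
      sparseSqSq {p | p.2 < 2 ^ p.1 ∧ IsSelected lam (avg φ) (avg fun y => |φ y|) p.1 p.2}
        φ x := by
  classical
  set 𝒮 : Set (ℕ × ℕ) :=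
    {p | p.2 < 2 ^ p.1 ∧ IsSelected lam (avg φ) (avg fun y => |φ y|) p.1 p.2} with h𝒮
  set κ : ℕ → ℕ := fun n => ⌊x * 2 ^ n⌋₊ with hκd
  have hκ : ∀ n, κ n < 2 ^ n := fun n => by
    rw [hκd, Nat.floor_lt (mul_nonneg hx.1 (by positivity))]
    push_cast
    nlinarith [hx.2, (by positivity : (0 : ℝ) < 2 ^ n)]
  have hκ' : ∀ n, κ (n + 1) / 2 = κ n := fun n => by
    simp only [hκd]
    rw [← Nat.floor_div_natCast]
    congr 1
    push_cast
    rw [pow_succ]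
    ring
  have hH := isDyadicPair_avg hφ
  have e2 : sparseSqSq 𝒮 φ x = ∑' n : ℕ, ENNReal.ofReal
      (if IsSelected lam (avg φ) (avg fun y => |φ y|) n (κ n)
        then avg (fun y => |φ y|) n (κ n) ^ 2 else 0) := by
    unfold sparseSqSq
    rw [tsum_subtype 𝒮 (fun p : ℕ × ℕ => Set.indicator (dyadicI p.1 p.2)
      (fun _ => ENNReal.ofReal ((avg (fun y => |φ y|) p.1 p.2) ^ 2)) x)]
    have e3 := tsum_indicator_dyadicI hx.1 (fun p => 𝒮.indicator
      (fun p => ENNReal.ofReal ((avg (fun y => |φ y|) p.1 p.2) ^ 2)) p)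
    refine Eq.trans (tsum_congr fun p => ?_) (e3.trans (tsum_congr fun n => ?_))
    · by_cases h1 : p ∈ 𝒮 <;> by_cases h2 : x ∈ dyadicI p.1 p.2 <;> simp [h1, h2]
    · by_cases h : IsSelected lam (avg φ) (avg fun y => |φ y|) n (κ n)
      · rw [if_pos h]
        exact Set.indicator_of_mem (show (n, κ n) ∈ 𝒮 from ⟨hκ n, h⟩) _
      · rw [if_neg h, ENNReal.ofReal_zero]
        exact Set.indicator_of_notMem (fun hm : (n, κ n) ∈ 𝒮 => h hm.2) _
  have e1 : sqFnSq φ x = ∑' n : ℕ, ENNReal.ofReal (haarDiff φ n (κ n) ^ 2) :=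
    tsum_indicator_dyadicI hx.1 (fun p => ENNReal.ofReal (haarDiff φ p.1 p.2 ^ 2))
  rw [e1, e2]
  refine ENNReal.tsum_le_of_sum_range_le fun n => ?_
  rw [← ENNReal.ofReal_sum_of_nonneg fun _ _ => sq_nonneg _]
  have hnn : ∀ m, 0 ≤ (if IsSelected lam (avg φ) (avg fun y => |φ y|) m (κ m)
      then avg (fun y => |φ y|) m (κ m) ^ 2 else 0) := fun m => by split_ifs <;> positivity
  have hb := stopState_bounds hlam hH n (κ n) (hκ n)
  have hmain := sum_sq_sub_le hlam hH κ hκ hκ' n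
  calc _ ≤ ENNReal.ofReal (12 * lam ^ 2 * ∑ m ∈ Finset.range (n + 1),
        if IsSelected lam (avg φ) (avg fun y => |φ y|) m (κ m)
          then avg (fun y => |φ y|) m (κ m) ^ 2 else 0) := by
        refine ENNReal.ofReal_le_ofReal (le_trans ?_ hmain)
        have : 0 ≤ lam ^ 2 * (stopState lam (avg φ) (avg fun y => |φ y|) n (κ n)).1 ^ 2 := by
          positivity
        refine le_add_of_nonneg_right ?_
        linarith [hb.2.2.2]
    _ ≤ _ := by
        rw [ENNReal.ofReal_mul (by positivity), ENNReal.ofReal_sum_of_nonneg fun m _ => hnn m]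
        gcongr
        exact ENNReal.sum_le_tsum _

lemma isSparse_selected {ε : ℝ} (hε : 0 < ε) (hε1 : ε < 1) {u v : ℕ → ℕ → ℝ}
    (H : IsDyadicPair u v) :
    IsSparse ε {p | p.2 < 2 ^ p.1 ∧ IsSelected (4 / ε) u v p.1 p.2} := by
  have hlam : 2 < 4 / ε := by rw [lt_div_iff₀ hε]; linarith
  refine ⟨fun p hp => hp.1, fun p hp F hF => ?_⟩
  have h1 := sum_selected_descendants_le hlam H (F.sup Prod.fst) p.1 p.2 hp.1 F (by
    intro q hq
    obtain ⟨hqS, hqp⟩ := hF q hq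
    obtain ⟨d1, d2⟩ := descendant_of_ssubset hqp
    exact ⟨hqS.2, d1, (Finset.le_sup (f := Prod.fst) hq).trans (Nat.le_add_left _ _), d2⟩)
  refine h1.trans ?_
  rw [mul_comm]
  have hself : nodeBellman (4 / ε) u v p.1 p.2 ≤ 2 / (4 / ε) := by
    unfold nodeBellman
    rw [stopState_of_selected hp.2]
    exact bellman_self_le (by positivity)
  have hlen : 0 ≤ dyadicLen p.1 := by unfold dyadicLen; positivity
  refine mul_le_mul_of_nonneg_right ?_ hlen
  have hpos : 0 < 4 / ε - 2 := by linarith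
  calc 4 / ε / (4 / ε - 2) * nodeBellman (4 / ε) u v p.1 p.2
      ≤ 4 / ε / (4 / ε - 2) * (2 / (4 / ε)) := by gcongr
    _ = 2 / (4 / ε - 2) := by field_simp
    _ ≤ ε := by
        rw [div_le_iff₀ hpos, mul_sub, mul_div_cancel₀ _ hε.ne']
        linarith

/-- for every `ε ∈ (0,1)` there is a constant `C = C(ε)`, independent of `φ`,
such that for every `φ ∈ L¹(0,1)` there is an `ε`-sparse family `𝒮 ⊆ 𝒟` with
`Sφ(x) ≤ C · S^sp_𝒮 φ(x)` for a.e. `x ∈ (0,1)` (written with squares: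
`(Sφ)² ≤ C² (S^sp_𝒮 φ)²`). -/
theorem sparse_domination_squareFunction :
    ∀ ε : ℝ, 0 < ε → ε < 1 →
      ∃ C : ℝ, 0 < C ∧
        ∀ φ : ℝ → ℝ, Measurable φ → IntegrableOn φ (Set.Ico (0 : ℝ) 1) →
          ∃ 𝒮 : Set (ℕ × ℕ), IsSparse ε 𝒮 ∧
            ∀ᵐ x ∂(volume.restrict (Set.Ico (0 : ℝ) 1)),
              sqFnSq φ x ≤ ENNReal.ofReal (C ^ 2) * sparseSqSq 𝒮 φ x := by
  intro ε hε hε1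
  have hlam : 1 ≤ 4 / ε := by rw [le_div_iff₀ hε]; linarith
  refine ⟨Real.sqrt (12 * (4 / ε) ^ 2), by positivity, fun φ _ hφ => ⟨_,
    isSparse_selected hε hε1 (isDyadicPair_avg hφ), ?_⟩⟩
  filter_upwards [ae_restrict_mem measurableSet_Ico] with x hx
  rw [Real.sq_sqrt (by positivity)]
  exact sqFnSq_le hlam hx hφ
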